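/- Let Ω ⊂ ℂⁿ be a bounded domain with smooth boundary and suppose the signed distance function δ is γ-plurisubharmonic on bΩ for some γ > 0. Set η = 1 − 2/(2 + γ²). Then there exists an open neighborhood U of bΩ such that the function z ↦ −(−δ(z))^η is plurisubharmonic on U ∩ Ω, i.e. L_{−(−δ)^η}(z)(V,V) ≥ 0 for all z ∈ U ∩ Ω and all V ∈ ℂⁿ. -/

import Mathlib

noncomputable section

open Complex Metric Set
open scoped Classical RealInnerProductSpace

/-- Signed distance to the boundary of `Ω`: negative inside `Ω`, positive outside. -/
def sdist {n : ℕ} (Ω : Set (EuclideanSpace ℂ (Fin n))) (z : EuclideanSpace ℂ (Fin n)) : ℝ :=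
  if z ∈ Ω then -Metric.infDist z (frontier Ω) else Metric.infDist z (frontier Ω)

/-- `⟨∂f(p),V⟩ = Σ_k f_{z_k}(p) V_k`, the complex gradient pairing. -/
def dDir {n : ℕ} (f : EuclideanSpace ℂ (Fin n) → ℂ) (p V : EuclideanSpace ℂ (Fin n)) : ℂ :=
  (1/2 : ℂ) * (fderiv ℝ f p V - Complex.I * fderiv ℝ f p (Complex.I • V))

/-- `Σ_k f_{z̄_k}(p) conj (V_k)`, the conjugate gradient pairing. -/
def dbarDir {n : ℕ} (f : EuclideanSpace ℂ (Fin n) → ℂ) (p V : EuclideanSpace ℂ (Fin n)) : ℂ :=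
  (1/2 : ℂ) * (fderiv ℝ f p V + Complex.I * fderiv ℝ f p (Complex.I • V))

/-- Complex Hessian `L_f(p)(V,W) = Σ_{j,k} ∂²f/∂z_j∂z̄_k(p) V_j conj (W_k)`. -/
def cHess {n : ℕ} (f : EuclideanSpace ℂ (Fin n) → ℂ) (p V W : EuclideanSpace ℂ (Fin n)) : ℂ :=
  dDir (fun z => dbarDir f z W) p V

/-- Real Hessian `H_f(p)(V,W) = Σ_{j,k} ∂²f/∂x_j∂x_k(p) V_j W_k` in the underlying
real coordinates of `ℂⁿ ≅ ℝ^{2n}`. -/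
def rHess {n : ℕ} (f : EuclideanSpace ℂ (Fin n) → ℝ) (p V W : EuclideanSpace ℂ (Fin n)) : ℝ :=
  fderiv ℝ (fun z => fderiv ℝ f z W) p V

/-- `Ω ⊂ ℂⁿ` has smooth (`C^∞`) boundary: the signed distance function is smooth on an
open neighborhood of `frontier Ω` and has unit gradient there. -/
def HasSmoothBoundary {n : ℕ} (Ω : Set (EuclideanSpace ℂ (Fin n))) : Prop :=
  ∃ U : Set (EuclideanSpace ℂ (Fin n)), IsOpen U ∧ frontier Ω ⊆ U ∧
    ContDiffOn ℝ (⊤ : ℕ∞) (sdist Ω) U ∧ ∀ z ∈ U, ‖fderiv ℝ (sdist Ω) z‖ = 1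

/-- `V` lies in the cone `ℝT_p^γ(bΩ)`: `V` is real tangent at `p` and
`|⟨i∇δ(p),V⟩| ≤ γ ‖V − ⟨i∇δ(p),V⟩ i∇δ(p)‖`. -/
def memCone {n : ℕ} (Ω : Set (EuclideanSpace ℂ (Fin n))) (γ : ℝ) (p V : EuclideanSpace ℂ (Fin n)) : Prop :=
  fderiv ℝ (sdist Ω) p V = 0 ∧
    |⟪Complex.I • gradient (sdist Ω) p, V⟫| ≤
      γ * ‖V - ⟪Complex.I • gradient (sdist Ω) p, V⟫ •
        (Complex.I • gradient (sdist Ω) p)‖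

/-- `δ` is `γ`-plurisubharmonic on `bΩ`: `L_δ(p)(V,V) ≥ 0` for every `p ∈ bΩ` and every
`V` in the cone `ℝT_p^γ(bΩ)`. -/
def GammaPsh {n : ℕ} (Ω : Set (EuclideanSpace ℂ (Fin n))) (γ : ℝ) : Prop :=
  ∀ p ∈ frontier Ω, ∀ V : EuclideanSpace ℂ (Fin n),
    memCone Ω γ p V → 0 ≤ (cHess (fun w => ((sdist Ω w : ℝ) : ℂ)) p V V).re

section SecondOrder

variable {E : Type*} [NormedAddCommGroup E] [NormedSpace ℝ E]

lemma ContDiffAt.differentiableAt_fderiv {f : E → ℝ} {x : E} (hf : ContDiffAt ℝ 2 f x) :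
    DifferentiableAt ℝ (fderiv ℝ f) x :=
  (hf.fderiv_right (m := 1) (by norm_num)).differentiableAt (by norm_num)

lemma ContDiffAt.eventually_differentiableAt {f : E → ℝ} {x : E} (hf : ContDiffAt ℝ 2 f x) :
    ∀ᶠ y in nhds x, DifferentiableAt ℝ f y :=
  (hf.eventually (by simp)).mono fun _ h => h.differentiableAt (by norm_num)

lemma fderiv_fderiv_apply {f : E → ℝ} {x : E} (hf : ContDiffAt ℝ 2 f x) (V W : E) :
    fderiv ℝ (fun y => fderiv ℝ f y W) x V = fderiv ℝ (fderiv ℝ f) x V W := by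
  rw [fderiv_clm_apply hf.differentiableAt_fderiv (differentiableAt_const W)]
  simp

/-- The Hessian of a `C²` function is positive semidefinite at a local minimum. -/
lemma IsLocalMin.fderiv_fderiv_nonneg {g : E → ℝ} {x : E} (hmin : IsLocalMin g x)
    (hg : ContDiffAt ℝ 2 g x) (V : E) : 0 ≤ fderiv ℝ (fderiv ℝ g) x V V := by
  set φ : ℝ → ℝ := fun t => g (x + t • V) with hφ
  have hline : ∀ t : ℝ, HasDerivAt (fun t : ℝ => x + t • V) V t := fun t => by
    simpa using ((hasDerivAt_id t).smul_const V).const_add x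
  have hx : x + (0 : ℝ) • V = x := by simp
  have hcont : Filter.Tendsto (fun t : ℝ => x + t • V) (nhds 0) (nhds x) := by
    simpa using (hline 0).continuousAt.tendsto
  have hd1 : deriv φ =ᶠ[nhds 0] fun t => fderiv ℝ g (x + t • V) V := by
    filter_upwards [hcont.eventually hg.eventually_differentiableAt] with t ht
    exact (ht.hasFDerivAt.comp_hasDerivAt t (hline t)).deriv
  have hd2 : deriv (deriv φ) 0 = fderiv ℝ (fderiv ℝ g) x V V := by
    rw [hd1.deriv_eq]
    have h : HasFDerivAt (fun y => fderiv ℝ g y V) (fderiv ℝ (fun y => fderiv ℝ g y V) x)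
        (x + (0 : ℝ) • V) := by
      rw [hx]
      exact (hg.differentiableAt_fderiv.clm_apply (differentiableAt_const V)).hasFDerivAt
    exact (h.comp_hasDerivAt (0 : ℝ) (hline 0)).deriv.trans (fderiv_fderiv_apply hg V V)
  have hminφ : IsLocalMin φ 0 := by
    have := hcont.eventually hmin
    filter_upwards [this] with t ht
    simpa [hφ] using ht
  by_contra! hneg
  rw [← hd2] at hneg
  have hφc : ContinuousAt φ 0 := by
    refine ContinuousAt.comp (f := fun t : ℝ => x + t • V) ?_ (hline 0).continuousAt
    simpa using hg.continuousAt
  have hmax := isLocalMax_of_deriv_deriv_neg hneg hminφ.deriv_eq_zero hφc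
  have hconst : φ =ᶠ[nhds 0] fun _ => φ 0 := by
    filter_upwards [hminφ, hmax] with t h1 h2 using le_antisymm h2 h1
  have : deriv (deriv φ) 0 = 0 := by
    rw [hconst.deriv.deriv_eq]
    simp
  linarith

/-- The Hessian of `F ∘ f` for real-valued `f`. -/
lemma fderiv_fderiv_comp {f : E → ℝ} {F F' : ℝ → ℝ} {F'' : ℝ} {x : E} (hf : ContDiffAt ℝ 2 f x)
    (hF : ∀ᶠ t in nhds (f x), HasDerivAt F (F' t) t) (hF' : HasDerivAt F' F'' (f x)) (V : E) :
    fderiv ℝ (fun y => fderiv ℝ (fun w => F (f w)) y V) x V =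
      F' (f x) * fderiv ℝ (fderiv ℝ f) x V V + F'' * (fderiv ℝ f x V) ^ 2 := by
  have h1 : (fun y => fderiv ℝ (fun w => F (f w)) y V) =ᶠ[nhds x]
      fun y => F' (f y) * fderiv ℝ f y V := by
    filter_upwards [hf.continuousAt.eventually hF, hf.eventually_differentiableAt] with y hy hfy
    have := (hy.comp_hasFDerivAt y hfy.hasFDerivAt).fderiv
    simp only [Function.comp_def] at this
    simp [this]
  have h2 : HasFDerivAt (fun y => F' (f y)) (F'' • fderiv ℝ f x) x :=
    hF'.comp_hasFDerivAt x (hf.differentiableAt (by norm_num)).hasFDerivAt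
  have h3 : DifferentiableAt ℝ (fun y => fderiv ℝ f y V) x :=
    hf.differentiableAt_fderiv.clm_apply (differentiableAt_const V)
  rw [h1.fderiv_eq, (h2.fun_mul h3.hasFDerivAt).fderiv]
  simp [fderiv_fderiv_apply hf]
  ring

end SecondOrder

section ComplexHessian

variable {n : ℕ}

lemma re_cHess_ofReal {f : EuclideanSpace ℂ (Fin n) → ℝ} {p : EuclideanSpace ℂ (Fin n)}
    (hf : ContDiffAt ℝ 2 f p) (V : EuclideanSpace ℂ (Fin n)) :
    (cHess (fun w => (f w : ℂ)) p V V).re =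
      (fderiv ℝ (fderiv ℝ f) p V V + fderiv ℝ (fderiv ℝ f) p (I • V) (I • V)) / 4 := by
  have h1 : (fun z => dbarDir (fun w => (f w : ℂ)) z V) =ᶠ[nhds p]
      fun z => (1 / 2 : ℂ) * ((fderiv ℝ f z V : ℂ) + I * (fderiv ℝ f z (I • V) : ℂ)) := by
    filter_upwards [hf.eventually_differentiableAt] with z hz
    have := (ofRealCLM.hasFDerivAt.comp z hz.hasFDerivAt).fderiv
    simp only [Function.comp_def, ofRealCLM_apply] at this
    simp [dbarDir, this]
  have hd : ∀ W, HasFDerivAt (fun z => (fderiv ℝ f z W : ℂ))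
      (ofRealCLM.comp (fderiv ℝ (fun z => fderiv ℝ f z W) p)) p := fun W =>
    ofRealCLM.hasFDerivAt.comp p
      (hf.differentiableAt_fderiv.clm_apply (differentiableAt_const W)).hasFDerivAt
  have h2 := (((hd V).add ((hd (I • V)).const_mul I)).const_mul (1 / 2 : ℂ)).fderiv
  have h3 : fderiv ℝ (fun z => dbarDir (fun w => (f w : ℂ)) z V) p = _ := h1.fderiv_eq.trans h2
  simp only [cHess, dDir, h3]
  simp [fderiv_fderiv_apply hf]
  ring

/-- The trace of a real bilinear form over a complex line, `B(V,V) + B(iV,iV)`, depends on `V`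
only up to multiplication by a unit complex number. -/
lemma bilin_smul_add_I_smul (B : EuclideanSpace ℂ (Fin n) →L[ℝ] EuclideanSpace ℂ (Fin n) →L[ℝ] ℝ)
    (c : ℂ) (V : EuclideanSpace ℂ (Fin n)) :
    B (c • V) (c • V) + B (I • c • V) (I • c • V) =
      ‖c‖ ^ 2 * (B V V + B (I • V) (I • V)) := by
  have h1 : c • V = c.re • V + c.im • (I • V) := by
    ext i
    simp only [PiLp.smul_apply, PiLp.add_apply, smul_eq_mul, real_smul]
    conv_lhs => rw [← re_add_im c]
    ring
  have h2 : I • c • V = c.re • (I • V) - c.im • V := by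
    rw [h1]
    ext i
    simp only [PiLp.smul_apply, PiLp.add_apply, PiLp.sub_apply, smul_eq_mul, real_smul]
    linear_combination (c.im : ℂ) * V i * I_mul_I
  rw [h2, h1, ← normSq_eq_norm_sq, normSq_apply]
  simp only [map_add, map_sub, map_smul, add_apply,
    sub_apply, smul_apply, smul_eq_mul]
  ring

lemma real_inner_I_smul_left (x y : EuclideanSpace ℂ (Fin n)) : ⟪I • x, y⟫ = -⟪x, I • y⟫ := by
  simp only [PiLp.inner_apply, PiLp.smul_apply, smul_eq_mul, ← Finset.sum_neg_distrib]
  refine Finset.sum_congr rfl fun i _ => ?_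
  simp [Complex.inner]
  ring

/-- A unit multiple of `V` annihilated by the real functional `A`. -/
lemma exists_unit_smul_apply_eq_zero (A : EuclideanSpace ℂ (Fin n) →L[ℝ] ℝ)
    (V : EuclideanSpace ℂ (Fin n)) :
    ∃ c : ℂ, ‖c‖ = 1 ∧ A (c • V) = 0 ∧ A (I • c • V) ^ 2 = A V ^ 2 + A (I • V) ^ 2 := by
  obtain ⟨c, hc, h0⟩ : ∃ c : ℂ, ‖c‖ = 1 ∧ c.re * A V + c.im * A (I • V) = 0 := by
    set u : ℂ := ⟨-A (I • V), A V⟩ with hu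
    by_cases h : u = 0
    · refine ⟨1, by simp, ?_⟩
      have := congrArg Complex.im h
      simp only [hu, zero_im] at this
      simp [this]
    · refine ⟨(‖u‖⁻¹ : ℝ) * u, ?_, ?_⟩
      · simp [norm_ne_zero_iff.mpr h]
      · simp only [re_ofReal_mul, im_ofReal_mul, hu]
        ring
  have h1 : A (c • V) = c.re * A V + c.im * A (I • V) := by
    have : c • V = c.re • V + c.im • (I • V) := by
      ext i
      simp only [PiLp.smul_apply, PiLp.add_apply, smul_eq_mul, real_smul]
      conv_lhs => rw [← re_add_im c]
      ring
    simp [this]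
  have h2 := bilin_smul_add_I_smul (A.smulRight A) c V
  simp only [ContinuousLinearMap.smulRight_apply, smul_apply, smul_eq_mul,
    hc, h1, h0] at h2
  exact ⟨c, hc, h1.trans h0, by linarith⟩

end ComplexHessian

section SignedDistance

variable {n : ℕ} {Ω : Set (EuclideanSpace ℂ (Fin n))}

lemma sdist_of_mem {z : EuclideanSpace ℂ (Fin n)} (hz : z ∈ Ω) :
    sdist Ω z = -infDist z (frontier Ω) := if_pos hz

lemma sdist_eq_zero_of_mem_frontier {p : EuclideanSpace ℂ (Fin n)} (hp : p ∈ frontier Ω) :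
    sdist Ω p = 0 := by
  simp [sdist, infDist_zero_of_mem hp]

/-- Started from a point of `Ω`, the signed distance grows at most at unit speed. -/
lemma sdist_le_sdist_add_dist {z w : EuclideanSpace ℂ (Fin n)} (hz : z ∈ Ω) :
    sdist Ω w ≤ sdist Ω z + dist z w := by
  rw [sdist_of_mem hz]
  by_cases hw : w ∈ Ω
  · rw [sdist_of_mem hw]
    have := infDist_le_infDist_add_dist (s := frontier Ω) (x := z) (y := w)
    linarith
  · obtain ⟨y, hy, hyf⟩ : (segment ℝ z w ∩ frontier Ω).Nonempty := by
      by_contra hempty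
      have hcover : segment ℝ z w ⊆ interior Ω ∪ (closure Ω)ᶜ := fun y hy => by
        by_contra hyc
        exact hempty ⟨y, hy, not_not.mp fun h => hyc (Or.inr h), fun h => hyc (Or.inl h)⟩
      obtain ⟨y, -, hyi, hyc⟩ := (convex_segment (𝕜 := ℝ) z w).isPreconnected _ _
        isOpen_interior isClosed_closure.isOpen_compl hcover
        ⟨z, left_mem_segment ℝ z w, (hcover (left_mem_segment ℝ z w)).resolve_right
          fun h => h (subset_closure hz)⟩
        ⟨w, right_mem_segment ℝ z w, (hcover (right_mem_segment ℝ z w)).resolve_left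
          fun h => hw (interior_subset h)⟩
      exact hyc (interior_subset_closure hyi)
    have h1 := infDist_le_dist_of_mem (x := z) hyf
    have h2 := infDist_le_dist_of_mem (x := w) hyf
    have h3 := dist_add_dist_of_mem_segment hy
    rw [dist_comm w y] at h2
    simp only [sdist, if_neg hw]
    linarith

/-- At a point of `Ω` and its nearest boundary point the signed distance has the same gradient,
and its Hessian is larger at the interior point. -/
lemma sdist_compare_nearest (hΩ : IsOpen Ω) {z p : EuclideanSpace ℂ (Fin n)} (hz : z ∈ Ω)
    (hp : p ∈ frontier Ω) (hzp : infDist z (frontier Ω) = dist z p)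
    (hdz : ContDiffAt ℝ 2 (sdist Ω) z) (hdp : ContDiffAt ℝ 2 (sdist Ω) p) :
    fderiv ℝ (sdist Ω) z = fderiv ℝ (sdist Ω) p ∧
      ∀ V, fderiv ℝ (fderiv ℝ (sdist Ω)) p V V ≤ fderiv ℝ (fderiv ℝ (sdist Ω)) z V V := by
  set f : EuclideanSpace ℂ (Fin n) → ℝ := fun w => sdist Ω (w + (p - z)) with hf
  have hdf : ContDiffAt ℝ 2 f z := by
    refine ContDiffAt.comp z (g := sdist Ω) (f := fun w => w + (p - z)) ?_ (by fun_prop)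
    simpa using hdp
  have hmin : IsLocalMin (fun w => sdist Ω w - f w) z := by
    filter_upwards [hΩ.mem_nhds hz] with w hw
    have h := sdist_le_sdist_add_dist (w := w + (p - z)) hw
    have h' : dist w (w + (p - z)) = dist z p := by
      simp [dist_eq_norm]
    simp only [hf, add_sub_cancel, sdist_of_mem hz, sdist_eq_zero_of_mem_frontier hp, hzp]
    linarith
  have hd1 : fderiv ℝ f = fun w => fderiv ℝ (sdist Ω) (w + (p - z)) := by
    funext w
    exact fderiv_comp_add_right (p - z)
  have hd2 : fderiv ℝ (fderiv ℝ f) z = fderiv ℝ (fderiv ℝ (sdist Ω)) p := by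
    rw [hd1, fderiv_comp_add_right (p - z), add_sub_cancel]
  have hsub : fderiv ℝ (fun w => sdist Ω w - f w) =ᶠ[nhds z]
      fun w => fderiv ℝ (sdist Ω) w - fderiv ℝ f w := by
    filter_upwards [hdz.eventually_differentiableAt, hdf.eventually_differentiableAt] with w h1 h2
    exact fderiv_fun_sub h1 h2
  refine ⟨?_, fun V => ?_⟩
  · have h := hsub.eq_of_nhds.symm.trans hmin.fderiv_eq_zero
    simp only [hd1, add_sub_cancel] at h
    exact sub_eq_zero.mp h
  · have h := hmin.fderiv_fderiv_nonneg (hdz.sub hdf) V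
    rw [hsub.fderiv_eq,
      fderiv_fun_sub hdz.differentiableAt_fderiv hdf.differentiableAt_fderiv, hd2] at h
    simpa using h

/-- On a vector of a complex line meeting the cone the Levi form is nonnegative; on the others the
norm is controlled by the complex normal component. -/
lemma GammaPsh.levi_nonneg_or_norm_le {γ : ℝ} (hγ : 0 < γ) (h : GammaPsh Ω γ)
    {p : EuclideanSpace ℂ (Fin n)} (hp : p ∈ frontier Ω) (hd : ContDiffAt ℝ 2 (sdist Ω) p)
    (hnorm : ‖fderiv ℝ (sdist Ω) p‖ = 1) (V : EuclideanSpace ℂ (Fin n)) :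
    0 ≤ fderiv ℝ (fderiv ℝ (sdist Ω)) p V V + fderiv ℝ (fderiv ℝ (sdist Ω)) p (I • V) (I • V) ∨
      ‖V‖ ^ 2 ≤ (1 + γ⁻¹) ^ 2 *
        (fderiv ℝ (sdist Ω) p V ^ 2 + fderiv ℝ (sdist Ω) p (I • V) ^ 2) := by
  obtain ⟨c, hc, h0, h2⟩ := exists_unit_smul_apply_eq_zero (fderiv ℝ (sdist Ω) p) V
  by_cases hcone : memCone Ω γ p (c • V)
  · left
    have := h p hp _ hcone
    rw [re_cHess_ofReal hd, bilin_smul_add_I_smul, hc] at this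
    linarith
  · right
    have hgrad : ‖I • gradient (sdist Ω) p‖ = 1 := by
      rw [norm_smul, norm_I, one_mul, gradient, LinearIsometryEquiv.norm_map, hnorm]
    set b := ⟪I • gradient (sdist Ω) p, c • V⟫ with hb
    have hb' : b = -fderiv ℝ (sdist Ω) p (I • c • V) := by
      rw [hb, real_inner_I_smul_left, inner_gradient_left]
    have hlt : γ * ‖c • V - b • (I • gradient (sdist Ω) p)‖ < |b| := by
      by_contra! hle
      exact hcone ⟨h0, hle⟩
    have hV : ‖V‖ ≤ ‖c • V - b • (I • gradient (sdist Ω) p)‖ + |b| := by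
      calc ‖V‖ = ‖c • V‖ := by rw [norm_smul, hc, one_mul]
        _ ≤ _ := norm_le_norm_sub_add _ (b • (I • gradient (sdist Ω) p))
        _ = _ := by rw [norm_smul b, hgrad, mul_one, Real.norm_eq_abs]
    have hT : ‖c • V - b • (I • gradient (sdist Ω) p)‖ ≤ γ⁻¹ * |b| := by
      rw [inv_mul_eq_div, le_div_iff₀ hγ]
      linarith
    have hV' : ‖V‖ ≤ (1 + γ⁻¹) * |b| := by linarith
    calc ‖V‖ ^ 2 ≤ ((1 + γ⁻¹) * |b|) ^ 2 := by gcongr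
      _ = _ := by rw [mul_pow, sq_abs, hb', neg_sq, h2]

end SignedDistance

lemma hasDerivAt_neg_rpow_neg (η : ℝ) {t : ℝ} (ht : t < 0) :
    HasDerivAt (fun s => -Real.rpow (-s) η) (η * (-t) ^ (η - 1)) t := by
  have := ((hasDerivAt_neg t).rpow_const (p := η) (Or.inl (by linarith))).fun_neg
  exact this.congr_deriv (by ring)

lemma hasDerivAt_mul_rpow_neg (η : ℝ) {t : ℝ} (ht : t < 0) :
    HasDerivAt (fun s => η * (-s) ^ (η - 1)) (η * (1 - η) * (-t) ^ (η - 2)) t := by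
  have := ((hasDerivAt_neg t).rpow_const (p := η - 1) (Or.inl (by linarith))).const_mul η
  refine this.congr_deriv ?_
  rw [show η - 1 - 1 = η - 2 by ring]
  ring

/-- If `δ` is `γ`-plurisubharmonic on `bΩ` for some `γ > 0` and `η = 1 − 2/(2 + γ²)`, then
`−(−δ)^η` is plurisubharmonic on `U ∩ Ω` for some neighborhood `U` of `bΩ`. -/
theorem diederich_fornaess_exponent {n : ℕ} (Ω : Set (EuclideanSpace ℂ (Fin n)))
    (hopen : IsOpen Ω) (hconn : IsConnected Ω) (hbdd : Bornology.IsBounded Ω)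
    (hsmooth : HasSmoothBoundary Ω) (γ : ℝ) (hγ : 0 < γ)
    (hgpsh : GammaPsh Ω γ) :
    ∃ U : Set (EuclideanSpace ℂ (Fin n)), IsOpen U ∧ frontier Ω ⊆ U ∧
      ∀ z ∈ U ∩ Ω, ∀ V : EuclideanSpace ℂ (Fin n),
        0 ≤ (cHess
          (fun w => ((-Real.rpow (-(sdist Ω w)) (1 - 2 / (2 + γ ^ 2)) : ℝ) : ℂ))
          z V V).re := by
  obtain ⟨U, hU, hfU, hsm, hunit⟩ := hsmooth
  set η : ℝ := 1 - 2 / (2 + γ ^ 2) with hη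
  have hη1 : 0 < 1 - η := by
    rw [hη, sub_sub_cancel]
    positivity
  have hη0 : 0 ≤ η := by
    rw [hη, sub_nonneg, div_le_one (by positivity)]
    nlinarith
  have hdiff : ∀ z ∈ U, ContDiffAt ℝ 2 (sdist Ω) z := fun z hz =>
    (hsm.contDiffAt (hU.mem_nhds hz)).of_le (by
      exact WithTop.coe_le_coe.mpr (le_top : (2 : ℕ∞) ≤ ⊤))
  have hcomp : IsCompact (frontier Ω) := hbdd.isCompact_closure.of_isClosed_subset
    isClosed_frontier frontier_subset_closure
  obtain ⟨C, hC⟩ : ∃ C, ∀ p ∈ frontier Ω, ‖fderiv ℝ (fderiv ℝ (sdist Ω)) p‖ ≤ C := by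
    refine hcomp.exists_bound_of_continuousOn (f := fderiv ℝ (fderiv ℝ (sdist Ω)))
      fun p hp => ContinuousAt.continuousWithinAt ?_
    have h1 := (hdiff p (hfU hp)).fderiv_right (m := 1) (by norm_num)
    exact (h1.fderiv_right (m := 0) (by norm_num)).continuousAt
  obtain ⟨ε, hε, hεU⟩ := hcomp.exists_thickening_subset_open hU hfU
  set K : ℝ := 2 * |C| * (1 + γ⁻¹) ^ 2 with hK
  have hK0 : 0 ≤ K := by positivity
  set ρ : ℝ := min ε ((1 - η) / (K + 1)) with hρ
  have hρ0 : 0 < ρ := by positivity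
  refine ⟨thickening ρ (frontier Ω), isOpen_thickening,
    self_subset_thickening hρ0 _, ?_⟩
  rintro z ⟨hzρ, hzΩ⟩ V
  have hzU : z ∈ U := hεU (thickening_mono (min_le_left _ _) _ hzρ)
  have hne : (frontier Ω).Nonempty := by
    obtain ⟨y, hy, -⟩ := mem_thickening_iff.mp hzρ
    exact ⟨y, hy⟩
  obtain ⟨p, hp, hzp⟩ := hcomp.exists_infDist_eq_dist hne z
  have hpU := hfU hp
  set r := infDist z (frontier Ω) with hr
  have hrρ : r < ρ := by
    obtain ⟨y, hy, hzy⟩ := mem_thickening_iff.mp hzρ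
    exact (infDist_le_dist_of_mem hy).trans_lt hzy
  have hr0 : 0 < r := by
    rw [hzp, dist_pos]
    rintro rfl
    exact hopen.inter_frontier_eq.le ⟨hzΩ, hp⟩
  have hδ : sdist Ω z = -r := sdist_of_mem hzΩ
  have hneg : sdist Ω z < 0 := by linarith
  obtain ⟨hgrad, hhess⟩ := sdist_compare_nearest hopen hzΩ hp hzp (hdiff z hzU) (hdiff p hpU)
  set N : ℝ := fderiv ℝ (sdist Ω) p V ^ 2 + fderiv ℝ (sdist Ω) p (I • V) ^ 2 with hN
  have hN0 : 0 ≤ N := by positivity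
  set H : ℝ := fderiv ℝ (fderiv ℝ (sdist Ω)) z V V +
    fderiv ℝ (fderiv ℝ (sdist Ω)) z (I • V) (I • V) with hH
  have hHp := add_le_add (hhess V) (hhess (I • V))
  have key : 0 ≤ r * H + (1 - η) * N := by
    rcases hgpsh.levi_nonneg_or_norm_le hγ hp (hdiff p hpU) (hunit p hpU) V with h | h
    · have : 0 ≤ H := h.trans hHp
      positivity
    · have hB : ∀ W, -(|C| * ‖W‖ ^ 2) ≤ fderiv ℝ (fderiv ℝ (sdist Ω)) p W W := fun W => by
        refine neg_le_of_abs_le ?_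
        calc _ ≤ ‖fderiv ℝ (fderiv ℝ (sdist Ω)) p‖ * ‖W‖ * ‖W‖ :=
              (fderiv ℝ (fderiv ℝ (sdist Ω)) p).le_opNorm₂ W W
          _ ≤ |C| * ‖W‖ * ‖W‖ := by
              gcongr
              exact (hC p hp).trans (le_abs_self C)
          _ = _ := by ring
      have hIV : ‖I • V‖ = ‖V‖ := by rw [norm_smul, norm_I, one_mul]
      have h1 := hB V
      have h2 := hB (I • V)
      rw [hIV] at h2
      have h3 : -(K * N) ≤ H := by
        have : |C| * ‖V‖ ^ 2 ≤ |C| * ((1 + γ⁻¹) ^ 2 * N) := by gcongr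
        rw [hK]
        linarith
      have h4 : r * (K + 1) ≤ 1 - η := by
        rw [← le_div_iff₀ (by positivity)]
        exact hrρ.le.trans (min_le_right _ _)
      nlinarith [mul_le_mul_of_nonneg_left h3 hr0.le, mul_le_mul_of_nonneg_right h4 hN0,
        mul_nonneg hr0.le hN0]
  have hF : ∀ᶠ t in nhds (sdist Ω z),
      HasDerivAt (fun s => -Real.rpow (-s) η) (η * (-t) ^ (η - 1)) t := by
    filter_upwards [Iio_mem_nhds hneg] with t ht using hasDerivAt_neg_rpow_neg η ht
  have hF' := hasDerivAt_mul_rpow_neg η hneg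
  have hcd : ContDiffAt ℝ 2 (fun w => -Real.rpow (-(sdist Ω w)) η) z :=
    ((hdiff z hzU).neg.rpow_const_of_ne (by linarith)).neg
  have hpow : r ^ (η - 1) = r ^ (η - 2) * r := by
    rw [show η - 1 = η - 2 + 1 by ring, Real.rpow_add_one hr0.ne']
  rw [re_cHess_ofReal hcd, ← fderiv_fderiv_apply hcd, ← fderiv_fderiv_apply hcd,
    fderiv_fderiv_comp (hdiff z hzU) hF hF', fderiv_fderiv_comp (hdiff z hzU) hF hF', hgrad, hδ,
    neg_neg, hpow]
  have hfinal : 0 ≤ η * r ^ (η - 2) * (r * H + (1 - η) * N) / 4 := by positivity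
  refine hfinal.trans_eq ?_
  rw [hH, hN]
  ring
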